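/- Let G be a finite group and P a set of prime numbers. For every cyclic P-perfect subgroup C ≤ G, the function e_C belongs to RU_P(G). Moreover, if C and C' are cyclic P-perfect subgroups that are not conjugate in G, then e_C · e_{C'} = 0 (pointwise product), each e_C satisfies e_C · e_C = e_C, and the sum of e_C over a set of representatives of the conjugacy classes of cyclic P-perfect subgroups of G equals the constant function 1. -/

import Mathlib

open scoped Classical

/-- The subring `ℤ_(P) = ℤ[1/p : p ∉ P]` of `ℚ`, viewed inside `ℂ`. -/
noncomputable def ZPloc (P : Set ℕ) : Subring ℂ :=
  Subring.closure {z : ℂ | ∃ p : ℕ, p.Prime ∧ p ∉ P ∧ z = (p : ℂ)⁻¹}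

/-- `b` is the `P'`-part of `g`. -/
def IsPPrimePart {G : Type} [Group G] (P : Set ℕ) (g b : G) : Prop :=
  b ∈ Subgroup.zpowers g ∧
    (∀ p : ℕ, p.Prime → p ∣ orderOf b → p ∉ P) ∧
    (∀ p : ℕ, p.Prime → p ∣ orderOf (g * b⁻¹) → p ∈ P)

/-- Two subgroups of `G` are conjugate in `G`. -/
def SubConj {G : Type} [Group G] (C C' : Subgroup G) : Prop :=
  ∃ g : G, Subgroup.map (MulAut.conj g).toMonoidHom C = C'

/-- `C` is a cyclic subgroup whose order is not divisible by any prime in `P`. -/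
def CyclicPPerfect {G : Type} [Group G] (P : Set ℕ) (C : Subgroup G) : Prop :=
  IsCyclic C ∧ ∀ p : ℕ, p.Prime → p ∈ P → ¬ p ∣ Nat.card C

/-- The idempotent class function `e_C : G → ℂ`, equal to `1` at `g` iff `⟨g_{P'}⟩` is
conjugate in `G` to `C`, and `0` otherwise. -/
noncomputable def eIdem {G : Type} [Group G] (P : Set ℕ) (C : Subgroup G) : G → ℂ :=
  fun g => if ∃ b : G, IsPPrimePart P g b ∧ SubConj (Subgroup.zpowers b) C then 1 else 0

/-- `RU_P(G)`: the set of `ℤ_(P)`-linear combinations, inside the ring of functions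
`G → ℂ`, of characters of finite-dimensional complex representations of `G`. -/
noncomputable def RUP (G : Type) [Group G] [Fintype G] (P : Set ℕ) : Set (G → ℂ) :=
  {f | ∃ (n : ℕ) (c : Fin n → ℂ) (V : Fin n → FDRep ℂ G),
    (∀ i, c i ∈ ZPloc P) ∧ f = ∑ i, c i • (V i).character}

section Conjugacy

variable {G : Type} [Group G]

lemma SubConj.refl (C : Subgroup G) : SubConj C C :=
  ⟨1, by ext; simp⟩

lemma SubConj.symm {C D : Subgroup G} (h : SubConj C D) : SubConj D C := by
  obtain ⟨g, rfl⟩ := h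
  refine ⟨g⁻¹, ?_⟩
  rw [Subgroup.map_map]
  convert Subgroup.map_id C
  ext; simp [mul_assoc]

lemma SubConj.trans {C D E : Subgroup G} (h : SubConj C D) (h' : SubConj D E) : SubConj C E := by
  obtain ⟨g, rfl⟩ := h
  obtain ⟨k, rfl⟩ := h'
  refine ⟨k * g, ?_⟩
  rw [Subgroup.map_map]
  congr 1
  ext; simp [mul_assoc]

lemma subConj_zpowers_iff {x : G} {D : Subgroup G} :
    SubConj (Subgroup.zpowers x) D ↔ ∃ g : G, Subgroup.zpowers (g * x * g⁻¹) = D := by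
  simp [SubConj, MonoidHom.map_zpowers]

lemma SubConj.card_eq {C D : Subgroup G} (h : SubConj C D) : Nat.card C = Nat.card D := by
  obtain ⟨g, rfl⟩ := h
  exact (Subgroup.card_map_of_injective (MulAut.conj g).injective).symm

lemma zpowers_pow_le_zpowers_pow {x y : G} (h : x ∈ Subgroup.zpowers y) (n : ℕ) :
    Subgroup.zpowers (x ^ n) ≤ Subgroup.zpowers (y ^ n) := by
  obtain ⟨k, rfl⟩ := Subgroup.mem_zpowers_iff.mp h
  rw [Subgroup.zpowers_le, Subgroup.mem_zpowers_iff]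
  exact ⟨k, by rw [← zpow_natCast, ← zpow_natCast, zpow_comm]⟩

lemma SubConj.zpowers_pow {x y : G} (h : SubConj (Subgroup.zpowers x) (Subgroup.zpowers y))
    (n : ℕ) : SubConj (Subgroup.zpowers (x ^ n)) (Subgroup.zpowers (y ^ n)) := by
  obtain ⟨g, hg⟩ := subConj_zpowers_iff.mp h
  refine subConj_zpowers_iff.mpr ⟨g, ?_⟩
  rw [← conj_pow]
  exact le_antisymm
    (zpowers_pow_le_zpowers_pow (hg ▸ Subgroup.mem_zpowers (g * x * g⁻¹)) n)
    (zpowers_pow_le_zpowers_pow (hg ▸ Subgroup.mem_zpowers y) n)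

end Conjugacy

section PermutationCharacters

variable {G : Type} [Group G]

/-- The permutation character of `G` on the cosets of `H`, as an integer-valued function. -/
noncomputable def permChar (H : Subgroup G) (x : G) : ℤ :=
  Nat.card (MulAction.fixedBy (G ⧸ H) x)

/-- The ring of integer-valued functions on `G` generated by the permutation characters. -/
def permCharRing (G : Type) [Group G] : Subring (G → ℤ) :=
  Subring.closure (Set.range permChar)

lemma permChar_mem (H : Subgroup G) : permChar H ∈ permCharRing G :=
  Subring.subset_closure ⟨H, rfl⟩

lemma mk_mem_fixedBy_iff {H : Subgroup G} {x g : G} :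
    (g : G ⧸ H) ∈ MulAction.fixedBy (G ⧸ H) x ↔ g⁻¹ * x * g ∈ H := by
  rw [MulAction.mem_fixedBy, MulAction.Quotient.smul_coe, eq_comm, QuotientGroup.eq,
    smul_eq_mul, mul_assoc]

lemma permChar_ne_zero_iff [Finite G] {H : Subgroup G} {x : G} :
    permChar H x ≠ 0 ↔ ∃ g : G, g⁻¹ * x * g ∈ H := by
  rw [permChar, Nat.cast_ne_zero, Nat.card_ne_zero]
  constructor
  · rintro ⟨⟨q, hq⟩, -⟩
    induction q using QuotientGroup.induction_on with
    | H g => exact ⟨g, mk_mem_fixedBy_iff.mp hq⟩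
  · rintro ⟨g, hg⟩
    exact ⟨⟨⟨g, mk_mem_fixedBy_iff.mpr hg⟩⟩, inferInstance⟩

lemma card_mul_permChar (H : Subgroup G) (x : G) :
    (Nat.card H : ℤ) * permChar H x = Nat.card {g : G | g⁻¹ * x * g ∈ H} := by
  have hset : {g : G | g⁻¹ * x * g ∈ H} =
      QuotientGroup.mk ⁻¹' MulAction.fixedBy (G ⧸ H) x := by
    ext g
    exact mk_mem_fixedBy_iff.symm
  rw [permChar, hset, ← Nat.cast_mul, ← Nat.card_prod,
    ← Nat.card_congr (QuotientGroup.preimageMkEquivSubgroupProdSet H _)]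

lemma fixedBy_subset_of_mem_zpowers {α : Type*} [MulAction G α] {x y : G}
    (h : x ∈ Subgroup.zpowers y) : MulAction.fixedBy α y ⊆ MulAction.fixedBy α x := by
  intro a ha
  rw [MulAction.mem_fixedBy, ← MulAction.mem_stabilizer_iff] at ha ⊢
  exact (Subgroup.zpowers_le.mpr ha) h

lemma permChar_congr (H : Subgroup G) {x y : G}
    (h : SubConj (Subgroup.zpowers x) (Subgroup.zpowers y)) : permChar H x = permChar H y := by
  obtain ⟨g, hg⟩ := subConj_zpowers_iff.mp h
  have key : MulAction.fixedBy (G ⧸ H) (g * x * g⁻¹) = MulAction.fixedBy (G ⧸ H) y :=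
    Set.Subset.antisymm
      (fixedBy_subset_of_mem_zpowers (hg ▸ Subgroup.mem_zpowers y))
      (fixedBy_subset_of_mem_zpowers (hg ▸ Subgroup.mem_zpowers (g * x * g⁻¹)))
  rw [permChar, permChar, ← key, ← MulAction.smul_fixedBy,
    Nat.card_congr (Equiv.Set.image _ _ (MulAction.injective g))]
  rfl

lemma permCharRing_congr {f : G → ℤ} (hf : f ∈ permCharRing G) {x y : G}
    (h : SubConj (Subgroup.zpowers x) (Subgroup.zpowers y)) : f x = f y := by
  induction hf using Subring.closure_induction with
  | mem f hf => obtain ⟨H, rfl⟩ := hf; exact permChar_congr H h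
  | zero => rfl
  | one => rfl
  | add f g _ _ hf hg => simp [hf, hg]
  | neg f _ hf => simp [hf]
  | mul f g _ _ hf hg => simp [hf, hg]

lemma permChar_modEq [Finite G] {p n : ℕ} [Fact p.Prime] (H : Subgroup G) (x : G) :
    (permChar H x : ZMod p) = permChar H (x ^ p ^ n) := by
  let Y := MulAction.fixedBy (G ⧸ H) (x ^ p ^ n)
  have hmaps : ∀ q : Y, x • (q : G ⧸ H) ∈ Y := fun q => by
    have := q.2
    rw [MulAction.mem_fixedBy] at this ⊢
    rw [smul_smul, ← pow_succ, pow_succ', mul_smul, this]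
  let f : Function.End Y := fun q => ⟨x • (q : G ⧸ H), hmaps q⟩
  have hpow : ∀ (k : ℕ) (q : Y),
      (((f ^ k : Function.End Y) q : Y) : G ⧸ H) = x ^ k • (q : G ⧸ H) := by
    intro k
    induction k with
    | zero => intro q; simp; rfl
    | succ k ih =>
      intro q
      rw [pow_succ, pow_succ, mul_smul]
      exact ih (f q)
  have hf : f ^ p ^ n = 1 := by
    funext q
    exact Subtype.ext ((hpow _ q).trans q.2)
  have := Fintype.ofFinite Y
  have key := Equiv.Perm.card_fixedPoints_modEq hf
  rw [← Nat.card_eq_fintype_card, ← Nat.card_eq_fintype_card, ← ZMod.natCast_eq_natCast_iff] at key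
  rw [permChar, permChar, Int.cast_natCast, Int.cast_natCast, key]
  congr 1
  refine Nat.card_congr ⟨fun q => ⟨⟨q.1, ?_⟩, ?_⟩, fun q => ⟨q.1.1, ?_⟩, fun _ => rfl, fun _ => rfl⟩
  · exact fixedBy_subset_of_mem_zpowers (Subgroup.npow_mem_zpowers x _) q.2
  · exact Subtype.ext q.2
  · exact congrArg Subtype.val q.2

lemma permCharRing_modEq [Finite G] {f : G → ℤ} (hf : f ∈ permCharRing G) (p n : ℕ)
    [Fact p.Prime] (x : G) : (f x : ZMod p) = f (x ^ p ^ n) := by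
  induction hf using Subring.closure_induction with
  | mem f hf => obtain ⟨H, rfl⟩ := hf; exact permChar_modEq H x
  | zero => rfl
  | one => rfl
  | add f g _ _ hf hg => simp [hf, hg]
  | neg f _ hf => simp [hf]
  | mul f g _ _ hf hg => simp [hf, hg]

end PermutationCharacters

section Characters

open CategoryTheory MonoidalCategory

variable {G : Type} [Group G]

/-- The representation of `G` on complex-valued functions on the cosets of `H`. -/
noncomputable def cosetRep (H : Subgroup G) : Representation ℂ G (G ⧸ H → ℂ) where
  toFun x := LinearMap.funLeft ℂ ℂ (x⁻¹ • ·)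
  map_one' := by ext; simp [LinearMap.funLeft]
  map_mul' x y := by ext; simp [LinearMap.funLeft, mul_smul]

lemma character_cosetRep [Finite G] (H : Subgroup G) (x : G) :
    (FDRep.of (cosetRep H)).character x = permChar H x := by
  have := Fintype.ofFinite (G ⧸ H)
  change LinearMap.trace ℂ (G ⧸ H → ℂ) (cosetRep H x) = _
  rw [LinearMap.trace_eq_matrix_trace ℂ (Pi.basisFun ℂ (G ⧸ H)), Matrix.trace]
  simp only [Matrix.diag_apply, LinearMap.toMatrix_apply, Pi.basisFun_apply, Pi.basisFun_repr]
  have hdiag : ∀ q : G ⧸ H, cosetRep H x (Pi.single q 1) q =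
      if q ∈ MulAction.fixedBy (G ⧸ H) x then 1 else 0 := by
    intro q
    change (Pi.single q 1 : G ⧸ H → ℂ) (x⁻¹ • q) = _
    rw [Pi.single_apply]
    congr 1
    rw [MulAction.mem_fixedBy, inv_smul_eq_iff, eq_comm (a := q)]
  rw [Finset.sum_congr rfl fun q _ => hdiag q, Finset.sum_boole, permChar, Int.cast_natCast,
    Nat.card_eq_fintype_card, Fintype.card_subtype]

/-- The characters of `G`, as a submonoid of the ring of complex-valued functions on `G`. -/
noncomputable def characterSubmonoid (G : Type) [Group G] : Submonoid (G → ℂ) where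
  carrier := {f | ∃ V : FDRep ℂ G, f = V.character}
  one_mem' := by
    refine ⟨FDRep.of (Representation.trivial ℂ G ℂ), ?_⟩
    funext x
    change 1 = LinearMap.trace ℂ ℂ (Representation.trivial ℂ G ℂ x)
    simp
  mul_mem' := by
    rintro _ _ ⟨V, rfl⟩ ⟨W, rfl⟩
    exact ⟨V ⊗ W, (FDRep.char_tensor V W).symm⟩

variable [Fintype G] {P : Set ℕ}

lemma RUP.add {f g : G → ℂ} (hf : f ∈ RUP G P) (hg : g ∈ RUP G P) : f + g ∈ RUP G P := by
  obtain ⟨m, c, V, hc, rfl⟩ := hf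
  obtain ⟨n, d, W, hd, rfl⟩ := hg
  refine ⟨m + n, Fin.append c d, Fin.append V W, fun i => ?_, ?_⟩
  · refine Fin.addCases (fun i => ?_) (fun i => ?_) i
    · simpa using hc i
    · simpa using hd i
  · simp [Fin.sum_univ_add]

lemma RUP.smul {f : G → ℂ} (hf : f ∈ RUP G P) {c : ℂ} (hc : c ∈ ZPloc P) : c • f ∈ RUP G P := by
  obtain ⟨n, d, V, hd, rfl⟩ := hf
  exact ⟨n, fun i => c * d i, V, fun i => mul_mem hc (hd i), by simp [Finset.smul_sum, mul_smul]⟩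

lemma RUP.of_mem_closure {f : G → ℂ}
    (hf : f ∈ Subring.closure (characterSubmonoid G : Set (G → ℂ))) : f ∈ RUP G P := by
  rw [Subring.mem_closure_iff, Submonoid.closure_eq] at hf
  induction hf using AddSubgroup.closure_induction with
  | mem f hf =>
    obtain ⟨V, rfl⟩ := hf
    exact ⟨1, fun _ => 1, fun _ => V, fun _ => one_mem _, by simp⟩
  | zero => exact ⟨0, Fin.elim0, Fin.elim0, fun i => i.elim0, by simp⟩
  | add f g _ _ hf hg => exact RUP.add hf hg
  | neg f _ hf => simpa using RUP.smul hf (neg_mem (one_mem (ZPloc P)))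

lemma RUP.of_mem_permCharRing {f : G → ℤ} (hf : f ∈ permCharRing G) :
    (fun x => (f x : ℂ)) ∈ RUP G P := by
  apply RUP.of_mem_closure
  let φ : (G → ℤ) →+* (G → ℂ) := (Int.castRingHom ℂ).compLeft G
  have hle : permCharRing G ≤ (Subring.closure (characterSubmonoid G : Set (G → ℂ))).comap φ := by
    refine Subring.closure_le.mpr ?_
    rintro _ ⟨H, rfl⟩
    refine Subring.subset_closure ⟨FDRep.of (cosetRep H), ?_⟩
    funext x
    exact (character_cosetRep H x).symm
  exact hle hf

lemma inv_natCast_mem_ZPloc {n : ℕ} (hn : n ≠ 0) (h : ∀ p : ℕ, p.Prime → p ∣ n → p ∉ P) :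
    (n : ℂ)⁻¹ ∈ ZPloc P := by
  induction n using Nat.recOnMul with
  | zero => exact absurd rfl hn
  | one => simp
  | prime p hp => exact Subring.subset_closure ⟨p, hp, h p hp dvd_rfl, rfl⟩
  | mul a b ha hb =>
    rw [Nat.cast_mul, mul_inv]
    exact mul_mem
      (ha (left_ne_zero_of_mul hn) fun p hp hd => h p hp (hd.mul_right b))
      (hb (right_ne_zero_of_mul hn) fun p hp hd => h p hp (hd.mul_left a))

/-- An integer-valued function on `G` lies in `RU_P(G)` as soon as, for `p = 0` and for every
`p ∈ P`, some multiple of it that is nonzero modulo `p` is in the ring generated by the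
permutation characters. -/
lemma RUP.of_forall_exists_mul_mem {h : G → ℤ} (h0 : ∃ n : ℤ, n ≠ 0 ∧ n • h ∈ permCharRing G)
    (hP : ∀ p ∈ P, p.Prime → ∃ n : ℤ, ¬ (p : ℤ) ∣ n ∧ n • h ∈ permCharRing G) :
    (fun x => (h x : ℂ)) ∈ RUP G P := by
  let I : Ideal ℤ :=
    { carrier := {n | n • h ∈ permCharRing G}
      add_mem' := fun {a b} ha hb => by
        change (a + b) • h ∈ permCharRing G
        rw [add_smul]
        exact add_mem ha hb
      zero_mem' := by simp
      smul_mem' := fun c n hn => by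
        change (c • n) • h ∈ permCharRing G
        rw [smul_assoc]
        exact zsmul_mem hn c }
  obtain ⟨d, hd⟩ := (IsPrincipalIdealRing.principal I).principal
  have hmem : ∀ n : ℤ, n • h ∈ permCharRing G ↔ d ∣ n := fun n => by
    change n ∈ I ↔ _
    rw [hd, Ideal.submodule_span_eq, Ideal.mem_span_singleton]
  have hd0 : d ≠ 0 := by
    rintro rfl
    obtain ⟨n, hn, hn'⟩ := h0
    exact hn (zero_dvd_iff.mp ((hmem n).mp hn'))
  have hh : (d.natAbs : ℤ) • h ∈ permCharRing G := (hmem _).mpr (Int.dvd_natAbs_self)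
  have key := RUP.smul (RUP.of_mem_permCharRing (P := P) hh)
    (inv_natCast_mem_ZPloc (P := P) (Int.natAbs_ne_zero.mpr hd0) fun p hp hpd hpP => by
      obtain ⟨n, hn, hn'⟩ := hP p hpP hp
      exact hn ((Int.natCast_dvd.mpr hpd).trans ((hmem n).mp hn')))
  convert key using 1
  funext x
  have : (d.natAbs : ℂ) ≠ 0 := Nat.cast_ne_zero.mpr (Int.natAbs_ne_zero.mpr hd0)
  simp only [Pi.smul_apply, smul_eq_mul, Int.cast_mul, Int.cast_natCast]
  rw [inv_mul_cancel_left₀ this]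

end Characters

section Indicators

variable {G : Type} [Group G]

lemma subConj_zpowers_conj (g x : G) :
    SubConj (Subgroup.zpowers x) (Subgroup.zpowers (g⁻¹ * x * g)) :=
  subConj_zpowers_iff.mpr ⟨g⁻¹, by rw [inv_inv]⟩

variable [Finite G]

lemma exists_separating_of_exists_detecting {R : Type*} [CommRing R] [IsDomain R] {T : Set G}
    (hT : ∀ y ∈ T, ∀ z ∈ Subgroup.zpowers y, z ∈ T)
    (hφ : ∀ z ∈ T, ∃ φ ∈ permCharRing G, (φ z : R) ≠ 0 ∧
      ∀ r ∈ T, (φ r : R) ≠ 0 → ∃ g : G, g⁻¹ * r * g ∈ Subgroup.zpowers z)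
    {y : G} (hy : y ∈ T) :
    ∃ F ∈ permCharRing G, (F y : R) ≠ 0 ∧
      ∀ x ∈ T, ¬ SubConj (Subgroup.zpowers x) (Subgroup.zpowers y) → (F x : R) = 0 := by
  have := Fintype.ofFinite G
  choose! φ hφA hφz hφr using hφ
  let s : Finset G :=
    {z | z ∈ Subgroup.zpowers y ∧ Subgroup.zpowers z ≠ Subgroup.zpowers y}
  have hs : ∀ {z}, z ∈ s ↔ z ∈ Subgroup.zpowers y ∧ Subgroup.zpowers z ≠ Subgroup.zpowers y := by
    simp [s]
  have hval : ∀ x : G, (((φ y * ∏ z ∈ s, (((φ z z : ℤ) : G → ℤ) - φ z)) x : ℤ) : R) =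
      (φ y x : R) * ∏ z ∈ s, ((φ z z : R) - (φ z x : R)) := by
    intro x
    simp [Finset.prod_apply]
  refine ⟨φ y * ∏ z ∈ s, (((φ z z : ℤ) : G → ℤ) - φ z),
    mul_mem (hφA y hy) (prod_mem fun z hz => sub_mem (intCast_mem _ _)
      (hφA z (hT y hy z (hs.mp hz).1))), ?_, ?_⟩
  · rw [hval]
    refine mul_ne_zero (hφz y hy) (Finset.prod_ne_zero_iff.mpr fun z hz => ?_)
    obtain ⟨hzy, hne⟩ := hs.mp hz
    have hzT := hT y hy z hzy
    suffices h : (φ z y : R) = 0 by rw [h, sub_zero]; exact hφz z hzT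
    by_contra h
    obtain ⟨g, hg⟩ := hφr z hzT y hy h
    refine hne (Subgroup.eq_of_le_of_card_ge (Subgroup.zpowers_le.mpr hzy) ?_)
    rw [(subConj_zpowers_conj g y).card_eq]
    exact Subgroup.card_le_of_le (Subgroup.zpowers_le.mpr hg)
  · intro x hx hxy
    rw [hval]
    by_cases h : (φ y x : R) = 0
    · rw [h, zero_mul]
    obtain ⟨g, hg⟩ := hφr y hy x hx h
    have hconj := subConj_zpowers_conj g x
    have hmem : g⁻¹ * x * g ∈ s := hs.mpr ⟨hg, fun he => hxy (he ▸ hconj)⟩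
    rw [Finset.prod_eq_zero hmem, mul_zero]
    rw [permCharRing_congr (hφA _ (hT y hy _ hg)) hconj, sub_self]

/-- A weak form of Artin's theorem: the permutation characters span, rationally, all functions
that depend only on the conjugacy class of the cyclic subgroup generated by the argument. -/
lemma exists_zsmul_mem_permCharRing (G : Type) [Group G] [Finite G] :
    ∃ n : ℤ, n ≠ 0 ∧ ∀ b : G → ℤ,
      (∀ x y, SubConj (Subgroup.zpowers x) (Subgroup.zpowers y) → b x = b y) →
      n • b ∈ permCharRing G := by
  have := Fintype.ofFinite G
  have hsep : ∀ y : G, ∃ F ∈ permCharRing G, F y ≠ 0 ∧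
      ∀ x, ¬ SubConj (Subgroup.zpowers x) (Subgroup.zpowers y) → F x = 0 := by
    intro y
    obtain ⟨F, hF, hFy, hFx⟩ := exists_separating_of_exists_detecting (R := ℤ) (T := Set.univ)
      (fun _ _ _ _ => trivial) (fun z _ => ⟨permChar (Subgroup.zpowers z), permChar_mem _,
        permChar_ne_zero_iff.mpr ⟨1, by simp⟩, fun r _ h => permChar_ne_zero_iff.mp h⟩)
      (Set.mem_univ y)
    exact ⟨F, hF, hFy, fun x h => hFx x trivial h⟩
  choose F hFA hFy hFx using hsep
  let S : Setoid G := ⟨fun x y => SubConj (Subgroup.zpowers x) (Subgroup.zpowers y),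
    fun x => SubConj.refl _, fun h => h.symm, fun h h' => h.trans h'⟩
  have := Fintype.ofFinite (Quotient S)
  let v : Quotient S → ℤ := fun q => F q.out q.out
  refine ⟨∏ q, v q, Finset.prod_ne_zero_iff.mpr fun q _ => hFy _, fun b hb => ?_⟩
  have key : (∏ q, v q) • b =
      ∑ q : Quotient S, (b q.out * ∏ q' ∈ Finset.univ.erase q, v q') • F q.out := by
    funext x
    have hx : SubConj (Subgroup.zpowers x) (Subgroup.zpowers (⟦x⟧ : Quotient S).out) :=
      (Quotient.mk_out (s := S) x).symm
    rw [Finset.sum_apply, Finset.sum_eq_single (⟦x⟧ : Quotient S)]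
    · simp only [Pi.smul_apply, smul_eq_mul]
      rw [hb x _ hx, permCharRing_congr (hFA _) hx,
        ← Finset.mul_prod_erase Finset.univ v (Finset.mem_univ (⟦x⟧ : Quotient S))]
      ring
    · intro q _ hq
      rw [Pi.smul_apply, hFx, smul_zero]
      intro h
      refine hq ?_
      rw [← Quotient.out_eq q]
      exact (Quotient.sound (s := S) h).symm
    · simp
  rw [key]
  exact sum_mem fun q _ => zsmul_mem (hFA _) _

lemma exists_subgroup_detecting_mod {p : ℕ} [Fact p.Prime] {z : G} (hz : (orderOf z).Coprime p) :
    ∃ S : Subgroup G, ¬ (p : ℤ) ∣ permChar S z ∧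
      ∀ r : G, (orderOf r).Coprime p → permChar S r ≠ 0 →
        ∃ g : G, g⁻¹ * r * g ∈ Subgroup.zpowers z := by
  let C := Subgroup.zpowers z
  let N := Subgroup.normalizer (C : Set G)
  let D : Subgroup N := C.subgroupOf N
  let Q : Sylow p (N ⧸ D) := default
  let T : Subgroup N := (Q : Subgroup (N ⧸ D)).comap (QuotientGroup.mk' D)
  have hindex : ¬ p ∣ T.index := by
    rw [Subgroup.index_comap_of_surjective _ (QuotientGroup.mk'_surjective D)]
    exact Q.not_dvd_index
  have hTC : ∀ r : G, (orderOf r).Coprime p → r ∈ T.map N.subtype → r ∈ C := by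
    rintro _ hr ⟨r, hrT, rfl⟩
    rw [Subgroup.subtype_apply, Subgroup.orderOf_coe] at hr
    have hrQ : QuotientGroup.mk' D r ∈ (Q : Subgroup (N ⧸ D)) := hrT
    obtain ⟨k, hk⟩ := (IsPGroup.iff_orderOf.mp Q.isPGroup') ⟨QuotientGroup.mk' D r, hrQ⟩
    rw [Subgroup.orderOf_mk] at hk
    have h1 : orderOf (QuotientGroup.mk' D r) = 1 :=
      Nat.eq_one_of_dvd_coprimes (hr.pow_right k) (orderOf_map_dvd _ r) hk.dvd
    rw [orderOf_eq_one_iff] at h1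
    exact (QuotientGroup.eq_one_iff r).mp h1
  have hCT : C ≤ T.map N.subtype := by
    intro c hc
    refine ⟨⟨c, Subgroup.le_normalizer hc⟩, ?_, rfl⟩
    have : QuotientGroup.mk' D ⟨c, Subgroup.le_normalizer hc⟩ = 1 :=
      (QuotientGroup.eq_one_iff _).mpr hc
    change QuotientGroup.mk' D _ ∈ (Q : Subgroup (N ⧸ D))
    rw [this]
    exact one_mem _
  have hconj : ∀ g r : G, (orderOf r).Coprime p → (orderOf (g⁻¹ * r * g)).Coprime p := by
    intro g r hr
    rw [← Nat.card_zpowers, ← (subConj_zpowers_conj g r).card_eq, Nat.card_zpowers]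
    exact hr
  refine ⟨T.map N.subtype, ?_, fun r hr h => ?_⟩
  · have hset : {g : G | g⁻¹ * z * g ∈ T.map N.subtype} = N := by
      ext g
      constructor
      · intro hg
        have hgC := hTC _ (hconj g z hz) hg
        have heq : Subgroup.zpowers (g⁻¹ * z * g) = C :=
          Subgroup.eq_of_le_of_card_ge (Subgroup.zpowers_le.mpr hgC)
            (subConj_zpowers_conj g z).card_eq.le
        have hmap : C.map (MulAut.conj g⁻¹).toMonoidHom = C := by
          refine Eq.trans ?_ heq
          rw [MonoidHom.map_zpowers]
          simp
        refine Subgroup.mem_normalizer_iff.mpr fun h => ?_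
        have := Subgroup.mem_map_equiv (f := MulAut.conj g⁻¹) (K := C) (x := h)
        rw [hmap] at this
        simpa using this
      · intro hg
        refine hCT ?_
        have := (Subgroup.mem_normalizer_iff.mp (inv_mem hg) z).mp (Subgroup.mem_zpowers z)
        simpa using this
    have hcard := card_mul_permChar (T.map N.subtype) z
    rw [hset, Subgroup.card_map_of_injective N.subtype_injective] at hcard
    have hN : Nat.card T * T.index = Nat.card N := T.card_mul_index
    have hpos : (Nat.card T : ℤ) ≠ 0 := Nat.cast_ne_zero.mpr Nat.card_pos.ne'
    have : permChar (T.map N.subtype) z = T.index := by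
      refine mul_left_cancel₀ hpos (hcard.trans ?_)
      rw [← Nat.cast_mul, hN]
      rfl
    rw [this]
    exact_mod_cast hindex
  · obtain ⟨g, hg⟩ := permChar_ne_zero_iff.mp h
    exact ⟨g, hTC _ (hconj g r hr) hg⟩

end Indicators

section Multiples

variable {G : Type} [Group G] [Finite G]

/-- A function is an integral combination of permutation characters, up to a factor prime to `p`,
if it is `0`-`1`-valued and depends only on the conjugacy class of the subgroup generated by the
`p'`-part of its argument. -/
lemma exists_zsmul_mem_of_forall_pow {p : ℕ} [Fact p.Prime] (h : G → ℤ)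
    (h01 : ∀ x, h x = 0 ∨ h x = 1)
    (hcongr : ∀ x y, SubConj (Subgroup.zpowers (x ^ ordProj[p] (Nat.card G)))
      (Subgroup.zpowers (y ^ ordProj[p] (Nat.card G))) → h x = h y) :
    ∃ n : ℤ, ¬ (p : ℤ) ∣ n ∧ n • h ∈ permCharRing G := by
  have := Fintype.ofFinite G
  have hp : p.Prime := Fact.out
  let q := ordProj[p] (Nat.card G)
  let T : Set G := {x | (orderOf x).Coprime p}
  have hTpow : ∀ x : G, x ^ q ∈ T := by
    intro x
    have hcop : (ordCompl[p] (Nat.card G)).Coprime p :=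
      (Nat.coprime_ordCompl hp Nat.card_pos.ne').symm
    refine hcop.coprime_dvd_left (orderOf_dvd_of_pow_eq_one ?_)
    rw [← pow_mul, Nat.ordProj_mul_ordCompl_eq_self, pow_card_eq_one']
  have hind : ∀ y : G, ∃ F ∈ permCharRing G, ∀ x : G,
      (F x : ZMod p) = if SubConj (Subgroup.zpowers (x ^ q)) (Subgroup.zpowers (y ^ q))
        then 1 else 0 := by
    intro y
    obtain ⟨F, hF, hFy, hFx⟩ := exists_separating_of_exists_detecting (R := ZMod p) (T := T)
      (fun y hy z hz => Nat.Coprime.coprime_dvd_left (orderOf_dvd_of_mem_zpowers hz) hy)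
      (fun z hz => by
        obtain ⟨S, hS, hS'⟩ := exists_subgroup_detecting_mod hz
        refine ⟨permChar S, permChar_mem S, ?_, fun r hr hr0 => hS' r hr ?_⟩
        · rwa [Ne, ZMod.intCast_zmod_eq_zero_iff_dvd]
        · rintro h0
          simp [h0] at hr0)
      (hTpow y)
    refine ⟨F ^ (p - 1), pow_mem hF _, fun x => ?_⟩
    rw [Pi.pow_apply, Int.cast_pow, permCharRing_modEq hF p _ x]
    split_ifs with hxy
    · refine ZMod.pow_card_sub_one_eq_one ?_
      rw [permCharRing_congr hF hxy]
      exact hFy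
    · rw [hFx _ (hTpow x) hxy, zero_pow (Nat.sub_ne_zero_of_lt hp.one_lt)]
  choose F hFA hF using hind
  obtain ⟨f, hfA, hf⟩ : ∃ f ∈ permCharRing G, ∀ x, (f x : ZMod p) = h x := by
    refine ⟨1 - ∏ y with h y = 1, (1 - F y),
      sub_mem (one_mem _) (prod_mem fun y _ => sub_mem (one_mem _) (hFA y)), fun x => ?_⟩
    have hval : (((1 - ∏ y with h y = 1, (1 - F y)) x : ℤ) : ZMod p) =
        1 - ∏ y with h y = 1, (1 - (F y x : ZMod p)) := by
      simp [Finset.prod_apply]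
    rw [hval]
    rcases h01 x with hx | hx
    · rw [Finset.prod_eq_one, hx]
      · simp
      · intro y hy
        rw [hF, if_neg, sub_zero]
        intro hxy
        have := hcongr x y hxy
        simp_all
    · rw [Finset.prod_eq_zero (i := x) (by simp [hx]), hx]
      · simp
      · rw [hF, if_pos (SubConj.refl _), sub_self]
  obtain ⟨N, hN0, hN⟩ := exists_zsmul_mem_permCharRing G
  have hfin : FiniteMultiplicity (p : ℤ) N :=
    Int.finiteMultiplicity_iff.mpr ⟨by rw [Int.natAbs_natCast]; exact hp.ne_one, hN0⟩
  obtain ⟨m, hNm, hpm⟩ := hfin.exists_eq_pow_mul_and_not_dvd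
  set k := multiplicity (p : ℤ) N
  have hdvd : ∀ x, (p : ℤ) ^ k ∣ f x ^ p ^ k - h x := by
    intro x
    have h1 : (p : ℤ) ∣ f x - h x := by
      rw [← ZMod.intCast_zmod_eq_zero_iff_dvd, Int.cast_sub, hf, sub_self]
    have h2 := dvd_sub_pow_of_dvd_sub h1 k
    have h3 : h x ^ p ^ k = h x := by
      rcases h01 x with hx | hx <;> simp [hx, hp.ne_zero]
    rw [h3] at h2
    exact (pow_dvd_pow _ k.le_succ).trans h2
  choose b hb using hdvd
  refine ⟨m, hpm, ?_⟩
  have hpk : (p : ℤ) ^ k ≠ 0 := pow_ne_zero _ (Nat.cast_ne_zero.mpr hp.ne_zero)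
  have key : m • h = m • f ^ p ^ k - N • b := by
    funext x
    have := hb x
    simp only [Pi.smul_apply, Pi.sub_apply, Pi.pow_apply, smul_eq_mul, hNm]
    linear_combination (-m) * this
  rw [key]
  refine sub_mem (zsmul_mem (pow_mem hfA _) _) (hN b fun x y hxy => ?_)
  refine mul_left_cancel₀ hpk ?_
  rw [← hb, ← hb, permCharRing_congr hfA hxy, hcongr x y (hxy.zpowers_pow _)]

end Multiples

section PPart

lemma exists_mul_eq_and_primes_mem (P : Set ℕ) {k : ℕ} (hk : k ≠ 0) :
    ∃ n m : ℕ, n * m = k ∧ (∀ p : ℕ, p.Prime → p ∣ n → p ∈ P) ∧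
      ∀ p : ℕ, p.Prime → p ∣ m → p ∉ P := by
  induction k using Nat.recOnMul with
  | zero => exact absurd rfl hk
  | one => exact ⟨1, 1, rfl, fun p hp h => absurd h hp.not_dvd_one,
      fun p hp h => absurd h hp.not_dvd_one⟩
  | prime q hq =>
    by_cases hqP : q ∈ P
    · exact ⟨q, 1, mul_one q, fun p hp h => (Nat.prime_dvd_prime_iff_eq hp hq).mp h ▸ hqP,
        fun p hp h => absurd h hp.not_dvd_one⟩
    · exact ⟨1, q, one_mul q, fun p hp h => absurd h hp.not_dvd_one,
        fun p hp h => (Nat.prime_dvd_prime_iff_eq hp hq).mp h ▸ hqP⟩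
  | mul a b ha hb =>
    obtain ⟨n, m, rfl, hn, hm⟩ := ha (left_ne_zero_of_mul hk)
    obtain ⟨n', m', rfl, hn', hm'⟩ := hb (right_ne_zero_of_mul hk)
    exact ⟨n * n', m * m', by ring,
      fun p hp h => (hp.dvd_mul.mp h).elim (hn p hp) (hn' p hp),
      fun p hp h => (hp.dvd_mul.mp h).elim (hm p hp) (hm' p hp)⟩

variable {G : Type} [Group G]

lemma coprime_of_primes_mem {P : Set ℕ} {n m : ℕ} (hn : ∀ p : ℕ, p.Prime → p ∣ n → p ∈ P)
    (hm : ∀ p : ℕ, p.Prime → p ∣ m → p ∉ P) : n.Coprime m :=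
  Nat.coprime_of_dvd fun p hp hpn hpm => hm p hp hpm (hn p hp hpn)

lemma zpowers_pow_eq_of_coprime {b : G} {n : ℕ} (h : (orderOf b).Coprime n) :
    Subgroup.zpowers (b ^ n) = Subgroup.zpowers b := by
  obtain ⟨k, hk⟩ := exists_pow_eq_self_of_coprime h.symm
  refine le_antisymm (Subgroup.zpowers_le.mpr (Subgroup.npow_mem_zpowers b n))
    (Subgroup.zpowers_le.mpr (Subgroup.mem_zpowers_iff.mpr ⟨k, ?_⟩))
  rw [zpow_natCast, hk]

lemma IsPPrimePart.zpowers_eq [Finite G] {P : Set ℕ} {n m : ℕ} (hnm : n * m = Nat.card G)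
    (hn : ∀ p : ℕ, p.Prime → p ∣ n → p ∈ P) (hm : ∀ p : ℕ, p.Prime → p ∣ m → p ∉ P)
    {g b : G} (h : IsPPrimePart P g b) :
    Subgroup.zpowers b = Subgroup.zpowers (g ^ n) := by
  obtain ⟨hbg, hb, hu⟩ := h
  have hcomm : Commute (g * b⁻¹) b := by
    obtain ⟨k, rfl⟩ := Subgroup.mem_zpowers_iff.mp hbg
    exact ((Commute.refl g).zpow_right k).mul_left (Commute.inv_left (Commute.refl _))
  have hun : (g * b⁻¹) ^ n = 1 := by
    refine orderOf_dvd_iff_pow_eq_one.mp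
      ((coprime_of_primes_mem hu hm).dvd_of_dvd_mul_right ?_)
    rw [hnm]
    exact orderOf_dvd_natCard _
  have hgn : g ^ n = b ^ n := by
    conv_lhs => rw [← inv_mul_cancel_right g b, hcomm.mul_pow, hun, one_mul]
  rw [hgn, zpowers_pow_eq_of_coprime (coprime_of_primes_mem hn hb).symm]

lemma exists_isPPrimePart [Finite G] {P : Set ℕ} {n m : ℕ} (hnm : n * m = Nat.card G)
    (hn : ∀ p : ℕ, p.Prime → p ∣ n → p ∈ P) (hm : ∀ p : ℕ, p.Prime → p ∣ m → p ∉ P) (g : G) :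
    ∃ b, IsPPrimePart P g b := by
  have hcop := coprime_of_primes_mem hn hm
  obtain ⟨k, hkn, hkm⟩ := Nat.chineseRemainder hcop 0 1
  refine ⟨g ^ k, Subgroup.npow_mem_zpowers g k, fun p hp hd => ?_, fun p hp hd => ?_⟩
  · refine hm p hp (hd.trans (orderOf_dvd_of_pow_eq_one ?_))
    rw [← pow_mul, ← orderOf_dvd_iff_pow_eq_one]
    refine (orderOf_dvd_natCard g).trans ?_
    rw [← hnm]
    exact mul_dvd_mul_right (Nat.modEq_zero_iff_dvd.mp hkn) m
  · refine hn p hp (hd.trans (orderOf_dvd_of_pow_eq_one ?_))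
    have hcomm : Commute g (g ^ k)⁻¹ := ((Commute.refl g).pow_right k).inv_right
    rw [hcomm.mul_pow, inv_pow, mul_inv_eq_one, ← pow_mul, pow_eq_pow_iff_modEq]
    refine Nat.ModEq.of_dvd (orderOf_dvd_natCard g) ?_
    rw [← hnm, mul_comm k n]
    simpa using (hkm.symm.mul_left' n)

lemma eIdem_apply [Finite G] {P : Set ℕ} {n m : ℕ} (hnm : n * m = Nat.card G)
    (hn : ∀ p : ℕ, p.Prime → p ∣ n → p ∈ P) (hm : ∀ p : ℕ, p.Prime → p ∣ m → p ∉ P)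
    (C : Subgroup G) (g : G) :
    eIdem P C g = if SubConj (Subgroup.zpowers (g ^ n)) C then 1 else 0 := by
  have : (∃ b : G, IsPPrimePart P g b ∧ SubConj (Subgroup.zpowers b) C) ↔
      SubConj (Subgroup.zpowers (g ^ n)) C := by
    constructor
    · rintro ⟨b, hb, hbC⟩
      rwa [hb.zpowers_eq hnm hn hm] at hbC
    · intro h
      obtain ⟨b, hb⟩ := exists_isPPrimePart hnm hn hm g
      exact ⟨b, hb, by rwa [hb.zpowers_eq hnm hn hm]⟩
  simp only [eIdem, this]

lemma eIdem_mem_RUP [Fintype G] (P : Set ℕ) (C : Subgroup G) : eIdem P C ∈ RUP G P := by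
  obtain ⟨n, m, hnm, hn, hm⟩ := exists_mul_eq_and_primes_mem P (Nat.card_pos (α := G)).ne'
  let h : G → ℤ := fun g => if SubConj (Subgroup.zpowers (g ^ n)) C then 1 else 0
  have hh : eIdem P C = fun x => (h x : ℂ) := by
    funext x
    rw [eIdem_apply hnm hn hm]
    simp [h]
  have hcongr : ∀ x y, SubConj (Subgroup.zpowers (x ^ n)) (Subgroup.zpowers (y ^ n)) →
      h x = h y := fun x y hxy => if_congr ⟨hxy.symm.trans, hxy.trans⟩ rfl rfl
  rw [hh]
  apply RUP.of_forall_exists_mul_mem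
  · obtain ⟨N, hN0, hN⟩ := exists_zsmul_mem_permCharRing G
    exact ⟨N, hN0, hN h fun x y hxy => hcongr x y (hxy.zpowers_pow n)⟩
  · intro p hpP hp
    have : Fact p.Prime := ⟨hp⟩
    refine exists_zsmul_mem_of_forall_pow h (fun x => (ite_eq_or_eq _ _ _).symm)
      fun x y hxy => hcongr x y ?_
    have hpm : (ordProj[p] (Nat.card G)).Coprime m :=
      ((Nat.Prime.coprime_iff_not_dvd hp).mpr fun hd => hm p hp hd hpP).pow_left _
    obtain ⟨c, hc⟩ : ordProj[p] (Nat.card G) ∣ n :=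
      hpm.dvd_of_dvd_mul_right (hnm ▸ Nat.ordProj_dvd _ _)
    rw [hc, pow_mul, pow_mul]
    exact hxy.zpowers_pow c

end PPart

/-- each `e_C` (for `C` cyclic `P`-perfect) lies in `RU_P(G)`; the `e_C` are
mutually orthogonal idempotents, and they sum to `1` over a set of representatives of the
conjugacy classes of cyclic `P`-perfect subgroups. -/
theorem eIdem_orthogonal_idempotents_sum_one (G : Type) [Group G] [Fintype G]
    (P : Set ℕ) (hP : ∀ p ∈ P, Nat.Prime p) :
    (∀ C : Subgroup G, CyclicPPerfect P C → eIdem P C ∈ RUP G P) ∧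
    (∀ C C' : Subgroup G, CyclicPPerfect P C → CyclicPPerfect P C' →
      ¬ SubConj C C' → eIdem P C * eIdem P C' = 0) ∧
    (∀ C : Subgroup G, CyclicPPerfect P C → eIdem P C * eIdem P C = eIdem P C) ∧
    (∀ s : Finset (Subgroup G), (∀ C ∈ s, CyclicPPerfect P C) →
      (∀ C : Subgroup G, CyclicPPerfect P C → ∃! C', C' ∈ s ∧ SubConj C C') →
      ∑ C ∈ s, eIdem P C = 1) := by

  obtain ⟨n, m, hnm, hn, hm⟩ := exists_mul_eq_and_primes_mem P (Nat.card_pos (α := G)).ne'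
  refine ⟨fun C _ => eIdem_mem_RUP P C, fun C C' _ _ hCC' => ?_, fun C _ => ?_, fun s hs hrep => ?_⟩
  · funext g
    rw [Pi.mul_apply, eIdem_apply hnm hn hm, eIdem_apply hnm hn hm]
    split_ifs with h h'
    · exact absurd (h.symm.trans h') hCC'
    all_goals simp
  · funext g
    rw [Pi.mul_apply, eIdem_apply hnm hn hm]
    split_ifs <;> simp
  · funext g
    have hD : CyclicPPerfect P (Subgroup.zpowers (g ^ n)) := by
      refine ⟨inferInstance, fun p hp hpP hd => hm p hp (hd.trans ?_) hpP⟩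
      rw [Nat.card_zpowers]
      refine orderOf_dvd_of_pow_eq_one ?_
      rw [← pow_mul, hnm, pow_card_eq_one']
    obtain ⟨C, ⟨hCs, hC⟩, huniq⟩ := hrep _ hD
    rw [Finset.sum_apply, Finset.sum_eq_single_of_mem C hCs]
    · rw [eIdem_apply hnm hn hm, if_pos hC, Pi.one_apply]
    · intro C' hC's hne
      rw [eIdem_apply hnm hn hm, if_neg fun h => hne (huniq C' ⟨hC's, h⟩)]
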